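/- arXiv:1806.05529 — 2 statements merged into one kernel-verified Lean document; each statement's English description precedes it below -/
import Mathlib

section
/- The Lie ideal of L_p generated by v_1, …, v_{p−1} is an abelian ideal, the Lie subalgebra of L_p generated by a_1, …, a_{p−1} is an abelian subalgebra, and L_p is the internal direct sum (as a K-vector space) of this ideal and this subalgebra; in particular L_p is metabelian, i.e. its derived subalgebra is abelian. -/
namespace Paper

variable (K : Type) [Field K] (p : ℕ)

abbrev Idx (p : ℕ) : Type := (ZMod p)ˣ ⊕ (ZMod p)ˣ

/-- The Lie ideal of the free Lie algebra generated by the `v`-generators. -/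
noncomputable def vIdealFree : LieIdeal K (FreeLieAlgebra K (Idx p)) :=
  LieSubmodule.lieSpan K _ (Set.range fun i => FreeLieAlgebra.of K (Sum.inr i : Idx p))

noncomputable def rels : Set (FreeLieAlgebra K (Idx p)) :=
  { z : FreeLieAlgebra K (Idx p) | ∃ i j : (ZMod p)ˣ,
      z = ⁅FreeLieAlgebra.of K (Sum.inl i : Idx p), FreeLieAlgebra.of K (Sum.inl j : Idx p)⁆ } ∪
  { z : FreeLieAlgebra K (Idx p) | ∃ u ∈ vIdealFree K p, ∃ w ∈ vIdealFree K p, z = ⁅u, w⁆ }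

noncomputable def relIdeal : LieIdeal K (FreeLieAlgebra K (Idx p)) :=
  LieSubmodule.lieSpan K _ (rels K p)

abbrev Lp : Type := FreeLieAlgebra K (Idx p) ⧸ relIdeal K p

noncomputable def gen (x : Idx p) : Lp K p :=
  LieSubmodule.Quotient.mk (N := relIdeal K p) (FreeLieAlgebra.of K x)

noncomputable def aGen (i : (ZMod p)ˣ) : Lp K p := gen K p (Sum.inl i)
noncomputable def vGen (i : (ZMod p)ˣ) : Lp K p := gen K p (Sum.inr i)

/-- Left-normed bracket `[x, l₁, l₂, …]` in the generators. -/
noncomputable def lnb (x : Idx p) (l : List (Idx p)) : Lp K p :=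
  l.foldl (fun b y => ⁅b, gen K p y⁆) (gen K p x)

/-- Degree-`k` homogeneous component: the span of left-normed brackets of length `k`. -/
noncomputable def homog (k : ℕ) : Submodule K (Lp K p) :=
  Submodule.span K { z | ∃ x l, l.length + 1 = k ∧ z = lnb K p x l }

/-- Fixed-point subspace of a Lie algebra automorphism. -/
noncomputable def fixedSubmodule (e : Lp K p ≃ₗ⁅K⁆ Lp K p) : Submodule K (Lp K p) where
  carrier := { x | e x = x }
  add_mem' := by
    intro a b ha hb
    simp only [Set.mem_setOf_eq] at *
    rw [show e (a + b) = e a + e b from map_add e.toLinearEquiv a b, ha, hb]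
  zero_mem' := by
    simp only [Set.mem_setOf_eq]
    rw [show e 0 = 0 from map_zero e.toLinearEquiv]
  smul_mem' := by
    intro c a ha
    simp only [Set.mem_setOf_eq] at *
    rw [show e (c • a) = c • e a from map_smul e.toLinearEquiv c a, ha]

/-- Eigenspace of a Lie algebra automorphism for the eigenvalue `c`. -/
noncomputable def eigSp (e : Lp K p ≃ₗ⁅K⁆ Lp K p) (c : K) : Submodule K (Lp K p) where
  carrier := { x | e x = c • x }
  add_mem' := by
    intro a b ha hb
    simp only [Set.mem_setOf_eq] at *
    rw [show e (a + b) = e a + e b from map_add e.toLinearEquiv a b, ha, hb, smul_add]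
  zero_mem' := by
    simp only [Set.mem_setOf_eq]
    rw [show e 0 = 0 from map_zero e.toLinearEquiv, smul_zero]
  smul_mem' := by
    intro d a ha
    simp only [Set.mem_setOf_eq] at *
    rw [show e (d • a) = d • e a from map_smul e.toLinearEquiv d a, ha, smul_comm]


/-- The Lie ideal of `L_p` generated by `v_1, …, v_{p−1}`. -/
noncomputable def vIdealLp (K : Type) [Field K] (p : ℕ) : LieIdeal K (Lp K p) :=
  LieSubmodule.lieSpan K (Lp K p) (Set.range (vGen K p))

/-- The Lie subalgebra of `L_p` generated by `a_1, …, a_{p−1}`. -/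
noncomputable def aSubalgebra (K : Type) [Field K] (p : ℕ) : LieSubalgebra K (Lp K p) :=
  LieSubalgebra.lieSpan K (Lp K p) (Set.range (aGen K p))

/-- The quotient map from the free Lie algebra onto `L_p`. -/
noncomputable def quotHom : FreeLieAlgebra K (Idx p) →ₗ⁅K⁆ Lp K p :=
  { (relIdeal K p).toSubmodule.mkQ with map_lie' := rfl }

variable {K p}

theorem quotHom_surjective : Function.Surjective (quotHom K p) :=
  Submodule.mkQ_surjective _

theorem quotHom_of (x : Idx p) : quotHom K p (FreeLieAlgebra.of K x) = gen K p x := rfl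

theorem quotHom_eq_zero_iff {z : FreeLieAlgebra K (Idx p)} :
    quotHom K p z = 0 ↔ z ∈ relIdeal K p :=
  Submodule.Quotient.mk_eq_zero _

theorem lie_aGen_aGen (i j : (ZMod p)ˣ) : ⁅aGen K p i, aGen K p j⁆ = 0 := by
  have h : quotHom K p ⁅FreeLieAlgebra.of K (Sum.inl i : Idx p),
      FreeLieAlgebra.of K (Sum.inl j : Idx p)⁆ = 0 :=
    quotHom_eq_zero_iff.2 (LieSubmodule.subset_lieSpan (Or.inl ⟨i, j, rfl⟩))
  rwa [LieHom.map_lie] at h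

theorem exists_mem_vIdealFree {x : Lp K p} (hx : x ∈ vIdealLp K p) :
    ∃ u ∈ vIdealFree K p, quotHom K p u = x := by
  have hle : vIdealLp K p ≤ (vIdealFree K p).map (quotHom K p) := by
    refine LieSubmodule.lieSpan_le.2 ?_
    rintro _ ⟨i, rfl⟩
    exact LieIdeal.mem_map (LieSubmodule.subset_lieSpan ⟨i, rfl⟩)
  obtain ⟨u, hu⟩ := LieIdeal.mem_map_of_surjective quotHom_surjective (hle hx)
  exact ⟨u, u.2, hu⟩

theorem lie_eq_zero_of_mem_vIdealLp {x y : Lp K p} (hx : x ∈ vIdealLp K p)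
    (hy : y ∈ vIdealLp K p) : ⁅x, y⁆ = 0 := by
  obtain ⟨u, hu, rfl⟩ := exists_mem_vIdealFree hx
  obtain ⟨w, hw, rfl⟩ := exists_mem_vIdealFree hy
  rw [← LieHom.map_lie]
  exact quotHom_eq_zero_iff.2 (LieSubmodule.subset_lieSpan (Or.inr ⟨u, hu, w, hw, rfl⟩))

theorem lie_eq_zero_of_mem_aSubalgebra {x y : Lp K p} (hx : x ∈ aSubalgebra K p)
    (hy : y ∈ aSubalgebra K p) : ⁅x, y⁆ = 0 := by
  have hab : IsLieAbelian (aSubalgebra K p) := by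
    refine LieSubalgebra.isLieAbelian_lieSpan_iff.2 ?_
    rintro _ ⟨i, rfl⟩ _ ⟨j, rfl⟩
    exact lie_aGen_aGen i j
  exact congrArg Subtype.val (hab.trivial ⟨x, hx⟩ ⟨y, hy⟩)

variable (K p) in
/-- The homomorphism from the free Lie algebra to `L_p` that maps each `a`-generator to its class
and kills each `v`-generator. -/
noncomputable def aProj : FreeLieAlgebra K (Idx p) →ₗ⁅K⁆ Lp K p :=
  FreeLieAlgebra.lift K (Sum.elim (aGen K p) fun _ => 0)

theorem aProj_inl (i : (ZMod p)ˣ) :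
    aProj K p (FreeLieAlgebra.of K (Sum.inl i : Idx p)) = aGen K p i :=
  FreeLieAlgebra.lift_of_apply _ _

theorem aProj_inr (i : (ZMod p)ˣ) :
    aProj K p (FreeLieAlgebra.of K (Sum.inr i : Idx p)) = 0 :=
  FreeLieAlgebra.lift_of_apply _ _

theorem vIdealFree_le_ker_aProj : vIdealFree K p ≤ (aProj K p).ker := by
  refine LieSubmodule.lieSpan_le.2 ?_
  rintro _ ⟨i, rfl⟩
  exact LieHom.mem_ker.2 (aProj_inr i)

theorem relIdeal_le_ker_aProj : relIdeal K p ≤ (aProj K p).ker := by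
  refine LieSubmodule.lieSpan_le.2 ?_
  rintro _ (⟨i, j, rfl⟩ | ⟨u, hu, w, -, rfl⟩)
  · refine LieHom.mem_ker.2 ?_
    rw [LieHom.map_lie, aProj_inl, aProj_inl, lie_aGen_aGen]
  · exact lie_mem_left K _ _ u w (vIdealFree_le_ker_aProj hu)

theorem aProj_mem (z : FreeLieAlgebra K (Idx p)) : aProj K p z ∈ aSubalgebra K p := by
  have h : aProj K p = (aSubalgebra K p).incl.comp (FreeLieAlgebra.lift K
      (Sum.elim (fun i => ⟨aGen K p i, LieSubalgebra.subset_lieSpan ⟨i, rfl⟩⟩) fun _ => 0)) := by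
    ext (i | i) <;> simp [aProj]
  rw [h]
  exact Subtype.prop _

theorem quotHom_sub_aProj_mem (z : FreeLieAlgebra K (Idx p)) :
    quotHom K p z - aProj K p z ∈ vIdealLp K p := by
  let q : Lp K p →ₗ⁅K⁆ Lp K p ⧸ vIdealLp K p :=
    { (vIdealLp K p).toSubmodule.mkQ with map_lie' := rfl }
  have h : q.comp (quotHom K p) = q.comp (aProj K p) := by
    ext (i | i)
    · rw [LieHom.comp_apply, LieHom.comp_apply, aProj_inl]
      rfl
    · rw [LieHom.comp_apply, LieHom.comp_apply, aProj_inr, map_zero]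
      exact (Submodule.Quotient.mk_eq_zero _).2 (LieSubmodule.subset_lieSpan ⟨i, rfl⟩)
  exact (Submodule.Quotient.eq _).1 (LieHom.congr_fun h z)

theorem exists_quotHom_eq_aProj_eq {x : Lp K p} (hx : x ∈ aSubalgebra K p) :
    ∃ z, quotHom K p z = x ∧ aProj K p z = x := by
  induction hx using LieSubalgebra.lieSpan_induction with
  | mem x h =>
    obtain ⟨i, rfl⟩ := h
    exact ⟨_, quotHom_of _, aProj_inl i⟩
  | zero => exact ⟨0, map_zero _, map_zero _⟩
  | add x y _ _ hx hy =>
    obtain ⟨z, hz, hz'⟩ := hx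
    obtain ⟨w, hw, hw'⟩ := hy
    exact ⟨z + w, by rw [map_add, hz, hw], by rw [map_add, hz', hw']⟩
  | smul c x _ hx =>
    obtain ⟨z, hz, hz'⟩ := hx
    exact ⟨c • z, by rw [map_smul, hz], by rw [map_smul, hz']⟩
  | lie x y _ _ hx hy =>
    obtain ⟨z, hz, hz'⟩ := hx
    obtain ⟨w, hw, hw'⟩ := hy
    exact ⟨⁅z, w⁆, by rw [LieHom.map_lie, hz, hw], by rw [LieHom.map_lie, hz', hw']⟩

theorem isCompl_vIdealLp_aSubalgebra :
    IsCompl (vIdealLp K p).toSubmodule (aSubalgebra K p).toSubmodule := by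
  constructor
  · rw [Submodule.disjoint_def]
    intro x hv ha
    obtain ⟨u, hu, hux⟩ := exists_mem_vIdealFree hv
    obtain ⟨z, hzx, rfl⟩ := exists_quotHom_eq_aProj_eq ha
    have hzu : z - u ∈ relIdeal K p := by
      rw [← quotHom_eq_zero_iff, map_sub, hzx, hux, sub_self]
    have h0 := LieHom.mem_ker.1 (relIdeal_le_ker_aProj hzu)
    rwa [map_sub, LieHom.mem_ker.1 (vIdealFree_le_ker_aProj hu), sub_zero] at h0
  · rw [codisjoint_iff, eq_top_iff]
    intro x _
    obtain ⟨z, rfl⟩ := quotHom_surjective x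
    exact Submodule.mem_sup.2
      ⟨_, quotHom_sub_aProj_mem z, _, aProj_mem z, sub_add_cancel _ _⟩

theorem derivedSeries_one_le_vIdealLp :
    LieAlgebra.derivedSeries K (Lp K p) 1 ≤ vIdealLp K p := by
  rw [LieAlgebra.derivedSeries_def, LieAlgebra.derivedSeriesOfIdeal_succ,
    LieAlgebra.derivedSeriesOfIdeal_zero, LieSubmodule.lie_le_iff]
  intro x _ y _
  obtain ⟨z, rfl⟩ := quotHom_surjective x
  obtain ⟨w, rfl⟩ := quotHom_surjective y
  have h := quotHom_sub_aProj_mem ⁅z, w⁆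
  rwa [LieHom.map_lie, LieHom.map_lie,
    lie_eq_zero_of_mem_aSubalgebra (aProj_mem z) (aProj_mem w), sub_zero] at h

/-- The ideal generated by the `v`'s is abelian, the subalgebra generated by the `a`'s is
abelian, `L_p` is the internal direct sum (as a `K`-vector space) of these two, and `L_p` is
metabelian (its derived subalgebra is abelian). -/
theorem lp_semidirect_decomposition (K : Type) [Field K] (p : ℕ) [Fact p.Prime]
    (hchar : ¬ (ringChar K ∣ p)) (ω : K) (hω : IsPrimitiveRoot ω p) :
    (∀ x ∈ vIdealLp K p, ∀ y ∈ vIdealLp K p, ⁅x, y⁆ = 0) ∧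
    (∀ x ∈ aSubalgebra K p, ∀ y ∈ aSubalgebra K p, ⁅x, y⁆ = 0) ∧
    IsCompl (vIdealLp K p).toSubmodule (aSubalgebra K p).toSubmodule ∧
    (∀ x ∈ LieAlgebra.derivedSeries K (Lp K p) 1,
      ∀ y ∈ LieAlgebra.derivedSeries K (Lp K p) 1, ⁅x, y⁆ = 0) := by
  exact ⟨fun _ hx _ hy => lie_eq_zero_of_mem_vIdealLp hx hy,
    fun _ hx _ hy => lie_eq_zero_of_mem_aSubalgebra hx hy,
    isCompl_vIdealLp_aSubalgebra,
    fun _ hx _ hy => lie_eq_zero_of_mem_vIdealLp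
      (derivedSeries_one_le_vIdealLp hx) (derivedSeries_one_le_vIdealLp hy)⟩

end Paper
end

section
/- For every k ≥ 2, dim_K(C_{L_p}(f) ∩ L_{p,k}) ≤ (p−1)^{k−1}. -/
namespace Paper

variable (K : Type) [Field K] (p : ℕ)

/-- A fixed vector of a linear map, lying in the span of eigenvectors for powers of a primitive
`p`-th root of unity, lies in the span of those eigenvectors whose eigenvalue is `1`. -/
theorem mem_span_image_of_apply_eq_self {K M ι : Type*} [Field K] [AddCommGroup M] [Module K M]
    {p : ℕ} (hp : (p : K) ≠ 0) {ω : K} (hω : IsPrimitiveRoot ω p) (F : M →ₗ[K] M) (b : ι → M)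
    (e : ι → ℕ) (hF : ∀ t, F (b t) = ω ^ e t • b t) {x : M}
    (hx : x ∈ Submodule.span K (Set.range b)) (hfix : F x = x) :
    x ∈ Submodule.span K (b '' {t | p ∣ e t}) := by
  have key : ∀ y ∈ Submodule.span K (Set.range b),
      (∑ n ∈ Finset.range p, F ^ n) y ∈ Submodule.span K (b '' {t | p ∣ e t}) := by
    intro y hy
    induction hy using Submodule.span_induction with
    | mem y hy =>
      obtain ⟨t, rfl⟩ := hy
      have hpow : ∀ n : ℕ, (F ^ n) (b t) = (ω ^ e t) ^ n • b t := by
        intro n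
        induction n with
        | zero => simp
        | succ n ih => rw [pow_succ', Module.End.mul_apply, ih, map_smul, hF, smul_smul, pow_succ]
      rw [LinearMap.sum_apply, Finset.sum_congr rfl fun n _ => hpow n, ← Finset.sum_smul]
      by_cases ht : p ∣ e t
      · exact Submodule.smul_mem _ _ (Submodule.subset_span ⟨t, ht, rfl⟩)
      · have hne : ω ^ e t ≠ 1 := fun h => ht ((hω.pow_eq_one_iff_dvd _).1 h)
        have hgeom : ∑ n ∈ Finset.range p, (ω ^ e t) ^ n = 0 := by
          rw [geom_sum_eq hne, ← pow_mul, mul_comm, pow_mul, hω.pow_eq_one, one_pow, sub_self,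
            zero_div]
        rw [hgeom, zero_smul]
        exact Submodule.zero_mem _
    | zero => rw [map_zero]; exact Submodule.zero_mem _
    | add y z _ _ hy hz => rw [map_add]; exact Submodule.add_mem _ hy hz
    | smul c y _ hy => rw [map_smul]; exact Submodule.smul_mem _ _ hy
  have hsum : (∑ n ∈ Finset.range p, F ^ n) x = (p : K) • x := by
    have hpow : ∀ n : ℕ, (F ^ n) x = x := by
      intro n
      induction n with
      | zero => simp
      | succ n ih => rw [pow_succ', Module.End.mul_apply, ih, hfix]
    rw [LinearMap.sum_apply, Finset.sum_congr rfl fun n _ => hpow n]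
    simp [Nat.cast_smul_eq_nsmul]
  exact (Submodule.smul_mem_iff _ hp).1 (hsum ▸ key x hx)

section Presentation

theorem lnb_concat (x : Idx p) (l : List (Idx p)) (y : Idx p) :
    lnb K p x (l ++ [y]) = ⁅lnb K p x l, gen K p y⁆ := by
  simp [lnb, List.foldl_append]

theorem lie_gen_inl_gen_inl (i j : (ZMod p)ˣ) : ⁅gen K p (Sum.inl i), gen K p (Sum.inl j)⁆ = 0 := by
  rw [gen, gen, ← LieSubmodule.Quotient.mk_bracket, LieSubmodule.Quotient.mk_eq_zero']
  exact LieSubmodule.subset_lieSpan (Or.inl ⟨i, j, rfl⟩)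

/-- The image in `Lp` of the ideal generated by the `v`-generators is abelian. -/
theorem lie_mk_mk_of_mem_vIdealFree {u w : FreeLieAlgebra K (Idx p)} (hu : u ∈ vIdealFree K p)
    (hw : w ∈ vIdealFree K p) :
    ⁅(LieSubmodule.Quotient.mk u : Lp K p), (LieSubmodule.Quotient.mk w : Lp K p)⁆ = 0 := by
  rw [← LieSubmodule.Quotient.mk_bracket, LieSubmodule.Quotient.mk_eq_zero']
  exact LieSubmodule.subset_lieSpan (Or.inr ⟨u, hu, w, hw, rfl⟩)

theorem of_inr_mem_vIdealFree (i : (ZMod p)ˣ) :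
    FreeLieAlgebra.of K (Sum.inr i : Idx p) ∈ vIdealFree K p :=
  LieSubmodule.subset_lieSpan ⟨i, rfl⟩

/-- A left-normed bracket starting with a `v`-generator lifts to the `v`-ideal. -/
theorem exists_mem_vIdealFree_lnb_eq (i : (ZMod p)ˣ) (l : List (Idx p)) :
    ∃ u ∈ vIdealFree K p, lnb K p (Sum.inr i) l = LieSubmodule.Quotient.mk u := by
  induction l using List.reverseRecOn with
  | nil => exact ⟨_, of_inr_mem_vIdealFree K p i, rfl⟩
  | append_singleton l y ih =>
    obtain ⟨u, hu, h⟩ := ih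
    refine ⟨⁅u, FreeLieAlgebra.of K y⁆, lie_mem_left K _ _ _ _ hu, ?_⟩
    rw [lnb_concat, h, gen, LieSubmodule.Quotient.mk_bracket]

theorem lie_lnb_inr_gen_inr (i j : (ZMod p)ˣ) (l : List (Idx p)) :
    ⁅lnb K p (Sum.inr i) l, gen K p (Sum.inr j)⁆ = 0 := by
  obtain ⟨u, hu, h⟩ := exists_mem_vIdealFree_lnb_eq K p i l
  rw [h, gen]
  exact lie_mk_mk_of_mem_vIdealFree K p hu (of_inr_mem_vIdealFree K p j)

/-- The bracket `[v_i, a_{j_1}, …, a_{j_m}]`. -/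
noncomputable def vaBracket {m : ℕ} (t : (ZMod p)ˣ × (Fin m → (ZMod p)ˣ)) : Lp K p :=
  lnb K p (Sum.inr t.1) (List.ofFn fun n => Sum.inl (t.2 n))

theorem lie_vaBracket_gen_inl {m : ℕ} (t : (ZMod p)ˣ × (Fin m → (ZMod p)ˣ)) (j : (ZMod p)ˣ) :
    ⁅vaBracket K p t, gen K p (Sum.inl j)⁆ =
      vaBracket K p (t.1, (Fin.snoc t.2 j : Fin (m + 1) → (ZMod p)ˣ)) := by
  simp only [vaBracket, List.ofFn_succ', Fin.snoc_castSucc, Fin.snoc_last, List.concat_eq_append,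
    lnb_concat]

theorem lie_gen_inr_gen_inl (i j : (ZMod p)ˣ) :
    ⁅gen K p (Sum.inr i), gen K p (Sum.inl j)⁆ = vaBracket K p (i, fun _ : Fin 1 => j) := by
  simp [vaBracket, lnb]

theorem lnb_mem_span_vaBracket (x : Idx p) (l : List (Idx p)) (m : ℕ) (hl : l.length = m + 1) :
    lnb K p x l ∈ Submodule.span K
      (Set.range fun t : (ZMod p)ˣ × (Fin (m + 1) → (ZMod p)ˣ) => vaBracket K p t) := by
  induction m generalizing l with
  | zero =>
    obtain ⟨y, rfl⟩ := List.length_eq_one_iff.1 hl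
    change ⁅gen K p x, gen K p y⁆ ∈ _
    rcases x with i | i <;> rcases y with j | j
    · rw [lie_gen_inl_gen_inl]
      exact Submodule.zero_mem _
    · rw [← lie_skew, lie_gen_inr_gen_inl]
      exact Submodule.neg_mem _ (Submodule.subset_span ⟨_, rfl⟩)
    · rw [lie_gen_inr_gen_inl]
      exact Submodule.subset_span ⟨_, rfl⟩
    · have h := lie_lnb_inr_gen_inr K p i j []
      rw [show lnb K p (Sum.inr i) [] = gen K p (Sum.inr i) from rfl] at h
      rw [h]
      exact Submodule.zero_mem _
  | succ m ih =>
    obtain rfl | ⟨l, y, rfl⟩ := List.eq_nil_or_concat l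
    · simp at hl
    rw [List.concat_eq_append, List.length_append, List.length_singleton] at hl
    rw [List.concat_eq_append, lnb_concat]
    have h := ih l (by omega)
    generalize lnb K p x l = z at h
    induction h using Submodule.span_induction with
    | mem z hz =>
      obtain ⟨t, rfl⟩ := hz
      rcases y with j | j
      · rw [lie_vaBracket_gen_inl]
        exact Submodule.subset_span ⟨_, rfl⟩
      · simp only [vaBracket]
        rw [lie_lnb_inr_gen_inr]
        exact Submodule.zero_mem _
    | zero => rw [zero_lie]; exact Submodule.zero_mem _
    | add y z _ _ hy hz => rw [add_lie]; exact Submodule.add_mem _ hy hz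
    | smul c y _ hy => rw [smul_lie]; exact Submodule.smul_mem _ _ hy

theorem homog_le_span_vaBracket (m : ℕ) :
    homog K p (m + 2) ≤ Submodule.span K
      (Set.range fun t : (ZMod p)ˣ × (Fin (m + 1) → (ZMod p)ˣ) => vaBracket K p t) := by
  refine Submodule.span_le.2 ?_
  rintro z ⟨x, l, hl, rfl⟩
  exact lnb_mem_span_vaBracket K p x l m (by omega)

variable {K p}

theorem map_lnb {ω : K} (f : Lp K p ≃ₗ⁅K⁆ Lp K p) (w : Idx p → ℕ)
    (hf : ∀ y, f (gen K p y) = ω ^ w y • gen K p y) (x : Idx p) (l : List (Idx p)) :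
    f (lnb K p x l) = ω ^ (w x + (l.map w).sum) • lnb K p x l := by
  induction l using List.reverseRecOn with
  | nil => simpa [lnb] using hf x
  | append_singleton l y ih =>
    rw [lnb_concat, LieEquiv.map_lie, ih, hf, smul_lie, lie_smul, smul_smul, ← pow_add]
    simp [add_assoc]

end Presentation

/-- For every `k ≥ 2`, `dim (C_{L_p}(f) ∩ L_{p,k}) ≤ (p−1)^{k−1}`. -/
theorem rank_fixed_f_inter_homog (K : Type) [Field K] (p : ℕ) [Fact p.Prime]
    (hchar : ¬ (ringChar K ∣ p)) (ω : K) (hω : IsPrimitiveRoot ω p)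
    (f : Lp K p ≃ₗ⁅K⁆ Lp K p)
    (hfa : ∀ i : (ZMod p)ˣ, f (aGen K p i) = ω ^ ((i : ZMod p)).val • aGen K p i)
    (hfv : ∀ i : (ZMod p)ˣ, f (vGen K p i) = ω ^ ((i : ZMod p)).val • vGen K p i) :
    ∀ k : ℕ, 2 ≤ k →
      Module.rank K (fixedSubmodule K p f ⊓ homog K p k : Submodule K (Lp K p))
        ≤ (((p - 1) ^ (k - 1) : ℕ) : Cardinal) := by
  intro k hk
  obtain ⟨m, rfl⟩ : ∃ m, k = m + 2 := ⟨k - 2, by omega⟩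
  have hp : (p : K) ≠ 0 := fun h => hchar ((ringChar.spec K p).1 h)
  let w : Idx p → ℕ := Sum.elim (fun i => (i : ZMod p).val) (fun i => (i : ZMod p).val)
  have hf : ∀ y, f (gen K p y) = ω ^ w y • gen K p y := by
    rintro (i | i)
    · exact hfa i
    · exact hfv i
  let e : (ZMod p)ˣ × (Fin (m + 1) → (ZMod p)ˣ) → ℕ := fun t =>
    w (Sum.inr t.1) + ((List.ofFn fun n => (Sum.inl (t.2 n) : Idx p)).map w).sum
  have he : ∀ t, ((e t : ℕ) : ZMod p) = t.1 + ∑ n, (t.2 n : ZMod p) := by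
    intro t
    simp only [e, List.map_ofFn, List.sum_ofFn]
    simp [w]
  have hle : fixedSubmodule K p f ⊓ homog K p (m + 2) ≤
      Submodule.span K (vaBracket K p '' {t | p ∣ e t}) := by
    rintro x ⟨hfix, hx⟩
    exact mem_span_image_of_apply_eq_self hp hω (f.toLinearEquiv : Lp K p →ₗ[K] Lp K p)
      (vaBracket K p) e (fun t => map_lnb f w hf _ _) (homog_le_span_vaBracket K p m hx) hfix
  have hinj : Function.Injective fun t : {t | p ∣ e t} => t.1.2 := by
    rintro ⟨⟨i, j⟩, ht⟩ ⟨⟨i', j'⟩, ht'⟩ h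
    obtain rfl : j = j' := h
    have h1 := (he _).symm.trans ((ZMod.natCast_eq_zero_iff _ _).2 ht)
    have h2 := (he _).symm.trans ((ZMod.natCast_eq_zero_iff _ _).2 ht')
    obtain rfl : i = i' := Units.ext (add_right_cancel (h1.trans h2.symm))
    rfl
  calc Module.rank K (fixedSubmodule K p f ⊓ homog K p (m + 2) : Submodule K (Lp K p))
      ≤ Module.rank K (Submodule.span K (vaBracket K p '' {t | p ∣ e t})) :=
        Submodule.rank_mono hle
    _ ≤ Cardinal.mk (vaBracket K p '' {t | p ∣ e t}) := rank_span_le _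
    _ ≤ Cardinal.mk {t | p ∣ e t} := Cardinal.mk_image_le
    _ ≤ Cardinal.mk (Fin (m + 1) → (ZMod p)ˣ) := Cardinal.mk_le_of_injective hinj
    _ = (((p - 1) ^ (m + 2 - 1) : ℕ) : Cardinal) := by
        rw [Cardinal.mk_fintype, Fintype.card_fun, ZMod.card_units, Fintype.card_fin]
        rfl

end Paper
end
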